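/- (Lemma 4.8, monotonicity of the truncated principal eigenvalue.) For every r > 0 and every y ∈ ℤ^d with y ≠ z, holding all other values of ξ and σ fixed: λ̂_r(z) is a non-decreasing function of ξ(y) ∈ ℝ, and λ̂_r(z) is a non-increasing function of σ(y) ∈ [δ_σ, ∞). -/

import Mathlib

open MeasureTheory ProbabilityTheory Filter Set

namespace BAM

/-- The lattice `ℤ^d`. -/
abbrev V (d : ℕ) : Type := Fin d → ℤ

/-- The `ℓ¹`-norm on `ℤ^d`, as a real number. -/
noncomputable def l1 {d : ℕ} (x : V d) : ℝ := ∑ i, |(x i : ℝ)|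

/-- The `ℓ¹`-ball of radius `r` around `z`. -/
def lball {d : ℕ} (z : V d) (r : ℝ) : Set (V d) := {x | l1 (x - z) ≤ r}

/-- The `i`-th coordinate unit vector. -/
def unitVec {d : ℕ} (i : Fin d) : V d := fun j => if j = i then 1 else 0

/-- The discrete Laplacian `(Δ f)(z) = (2d)⁻¹ Σ_{|y-z|=1} (f y - f z)`. -/
noncomputable def discLap {d : ℕ} (f : V d → ℝ) (z : V d) : ℝ :=
  (2 * (d : ℝ))⁻¹ * ∑ i : Fin d, ((f (z + unitVec i) - f z) + (f (z - unitVec i) - f z))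

/-- The Bouchaud–Anderson operator `Δ σ⁻¹ + ξ` acting on `f`. -/
noncomputable def bamOp {d : ℕ} (σf ξf : V d → ℝ) (f : V d → ℝ) (z : V d) : ℝ :=
  discLap (fun y => f y / σf y) z + ξf z * f z

/-- `lam` is an eigenvalue of the Dirichlet restriction of `Δ σ⁻¹ + ξ` to `S`. -/
def IsDirEV {d : ℕ} (σf ξf : V d → ℝ) (S : Set (V d)) (lam : ℝ) : Prop :=
  ∃ f : V d → ℝ, f ≠ 0 ∧ (∀ x ∉ S, f x = 0) ∧ ∀ x ∈ S, bamOp σf ξf f x = lam * f x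

/-- The principal (largest) Dirichlet eigenvalue of `Δ σ⁻¹ + ξ` in `S`. -/
noncomputable def prinEV {d : ℕ} (σf ξf : V d → ℝ) (S : Set (V d)) : ℝ :=
  sSup {lam | IsDirEV σf ξf S lam}

/-- Weak lexicographic order on `ℤ^d`. -/
def lexLe {d : ℕ} (x y : V d) : Prop :=
  x = y ∨ ∃ i : Fin d, (∀ j, j < i → x j = y j) ∧ x i < y i

/-- Upper tail of `ξ(0)`: `P(ξ(0) > r)` as a real number. -/
noncomputable def tailXi {Ω : Type*} [MeasurableSpace Ω] (P : Measure Ω) (ξ0 : Ω → ℝ) (r : ℝ) : ℝ :=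
  (P {ω | r < ξ0 ω}).toReal

/-- The function `F(r) = ln (− ln P(ξ(0) > r))` from Assumption (A.1). -/
noncomputable def Ffun {Ω : Type*} [MeasurableSpace Ω] (P : Measure Ω) (ξ0 : Ω → ℝ) (r : ℝ) : ℝ :=
  Real.log (-Real.log (tailXi P ξ0 r))

/-- Scale `a_t := inf {u > 1 : − ln P(ξ(0) > u) ≥ d ln t}`. -/
noncomputable def aScale {Ω : Type*} [MeasurableSpace Ω] (P : Measure Ω) (ξ0 : Ω → ℝ)
    (d : ℕ) (t : ℝ) : ℝ :=
  sInf {u : ℝ | 1 < u ∧ (d : ℝ) * Real.log t ≤ -Real.log (tailXi P ξ0 u)}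

noncomputable def log2 (t : ℝ) : ℝ := Real.log (Real.log t)
noncomputable def log3 (t : ℝ) : ℝ := Real.log (Real.log (Real.log t))

/-- The macrobox scale `L_t := t ln₂ t`. -/
noncomputable def Lscale (t : ℝ) : ℝ := t * log2 t

/-- `d_t := ρ/(d ln t)`. -/
noncomputable def dscale (ρ : ℝ) (d : ℕ) (t : ℝ) : ℝ := ρ / (d * Real.log t)

/-- `r_t := t d_t / ln₃ t`. -/
noncomputable def rscale (ρ : ℝ) (d : ℕ) (t : ℝ) : ℝ := t * dscale ρ d t / log3 t

/-- The set `Π_{L,η}` of high exceedances of the potential (in realisation `ξω`). -/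
noncomputable def PiSet {d : ℕ} {Ω : Type*} [MeasurableSpace Ω] (P : Measure Ω)
    (ξ : V d → Ω → ℝ) (ω : Ω) (L η : ℝ) : Set (V d) :=
  {x ∈ lball (0 : V d) L | aScale P (ξ 0) d L - η < ξ x ω}

/-- Solution property for the Cauchy problem of the BAM. -/
def IsSolution {d : ℕ} (σf ξf : V d → ℝ) (v : ℝ → V d → ℝ) : Prop :=
  (∀ t ≥ (0 : ℝ), ∀ z, 0 ≤ v t z) ∧
  (∀ z, v 0 z = if z = 0 then 1 else 0) ∧
  (∀ z : V d, ∀ t > (0 : ℝ),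
    HasDerivAt (fun s => v s z) (discLap (fun y => v t y / σf y) z + ξf z * v t z) t)

/-- The potential truncated outside `z` at level `a − c*` (with `c* = 4/δ_σ`)
and lifted at `z` to at least `a − c* + δ_σ⁻¹`. -/
noncomputable def hatXiAt {d : ℕ} (z : V d) (a δσ : ℝ) (ξf : V d → ℝ) (x : V d) : ℝ :=
  if x = z then max (ξf z) (a - 4 / δσ + δσ⁻¹) else min (ξf x) (a - 4 / δσ)

open scoped InnerProductSpace in
theorem exists_hasEigenvalue_forall_inner_le {E : Type*} [NormedAddCommGroup E]
    [InnerProductSpace ℝ E] [FiniteDimensional ℝ E] [Nontrivial E] {T : E →ₗ[ℝ] E}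
    (hT : T.IsSymmetric) :
    ∃ μ : ℝ, Module.End.HasEigenvalue T μ ∧ ∀ x, ⟪T x, x⟫_ℝ ≤ μ * ‖x‖ ^ 2 := by
  refine ⟨_, hT.hasEigenvalue_iSup_of_finiteDimensional, fun x => ?_⟩
  by_cases hx : x = 0
  · simp [hx]
  have hbdd : BddAbove (Set.range fun x : { x : E // x ≠ 0 } =>
      (RCLike.re ⟪T x, (x : E)⟫_ℝ / ‖(x : E)‖ ^ 2 : ℝ)) := by
    refine ⟨‖LinearMap.toContinuousLinearMap T‖, ?_⟩
    rintro _ ⟨⟨v, hv⟩, rfl⟩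
    have hv' : 0 < ‖v‖ := norm_pos_iff.mpr hv
    have h1 : ⟪T v, v⟫_ℝ ≤ ‖T v‖ * ‖v‖ := real_inner_le_norm _ _
    have h2 : ‖T v‖ ≤ ‖LinearMap.toContinuousLinearMap T‖ * ‖v‖ :=
      (LinearMap.toContinuousLinearMap T).le_opNorm v
    simp only [RCLike.re_to_real]
    rw [div_le_iff₀ (by positivity)]
    nlinarith
  have hle := le_ciSup hbdd ⟨x, hx⟩
  have hx' : 0 < ‖x‖ := norm_pos_iff.mpr hx
  rw [← div_le_iff₀ (by positivity)]
  simpa using hle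

section

variable {d : ℕ}

theorem discLap_add (f g : V d → ℝ) (x : V d) :
    discLap (fun w => f w + g w) x = discLap f x + discLap g x := by
  simp only [discLap, ← mul_add, ← Finset.sum_add_distrib]
  congr 1
  exact Finset.sum_congr rfl fun _ _ => by ring

theorem discLap_const_mul (c : ℝ) (f : V d → ℝ) (x : V d) :
    discLap (fun w => c * f w) x = c * discLap f x := by
  simp only [discLap, Finset.mul_sum]
  exact Finset.sum_congr rfl fun _ _ => by ring

theorem discLap_single (hd : 1 ≤ d) (z : V d) :
    discLap (fun w => if w = z then 1 else 0) z = -1 := by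
  have hu : ∀ i : Fin d, unitVec i ≠ 0 := fun i h => by
    simpa [unitVec] using congrFun h i
  have hd' : (d : ℝ) ≠ 0 := by positivity
  simp [discLap, hu]
  field_simp
  norm_num

theorem sum_mul_shift (S : Finset (V d)) {f g : V d → ℝ} (hf : ∀ x ∉ S, f x = 0)
    (hg : ∀ x ∉ S, g x = 0) (e : V d) :
    ∑ x ∈ S, f x * g (x + e) = ∑ x ∈ S, g x * f (x - e) := by
  have h1 : ∑ᶠ x, f x * g (x + e) = ∑ x ∈ S, f x * g (x + e) :=
    finsum_eq_sum_of_support_subset _ fun x hx => by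
      by_contra h
      exact hx (by simp [hf x h])
  have h2 : ∑ᶠ x, g x * f (x - e) = ∑ x ∈ S, g x * f (x - e) :=
    finsum_eq_sum_of_support_subset _ fun x hx => by
      by_contra h
      exact hx (by simp [hg x h])
  rw [← h1, ← h2, ← finsum_comp_equiv (Equiv.addRight e) (f := fun x => g x * f (x - e))]
  exact finsum_congr fun x => by simp [mul_comm]

theorem sum_mul_discLap_comm (S : Finset (V d)) {f g : V d → ℝ} (hf : ∀ x ∉ S, f x = 0)
    (hg : ∀ x ∉ S, g x = 0) :
    ∑ x ∈ S, f x * discLap g x = ∑ x ∈ S, g x * discLap f x := by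
  have key : ∀ u v : V d → ℝ, ∑ x ∈ S, u x * discLap v x =
      (2 * (d : ℝ))⁻¹ * ∑ i : Fin d, (∑ x ∈ S, u x * v (x + unitVec i)
        + ∑ x ∈ S, u x * v (x - unitVec i) - 2 * ∑ x ∈ S, u x * v x) := by
    intro u v
    simp only [discLap, Finset.mul_sum, ← Finset.sum_add_distrib, ← Finset.sum_sub_distrib]
    rw [Finset.sum_comm]
    exact Finset.sum_congr rfl fun _ _ => Finset.sum_congr rfl fun _ _ => by ring
  rw [key, key]
  congr 1
  refine Finset.sum_congr rfl fun i _ => ?_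
  rw [sum_mul_shift S hf hg, sum_mul_shift S hg hf]
  simp only [mul_comm (f _) (g _)]
  ring

/-- The quadratic form of `Δ + (ξ - λ) σ` on functions supported in `S`. -/
noncomputable def dirForm (σf ξf : V d → ℝ) (S : Finset (V d)) (lam : ℝ) (g : V d → ℝ) : ℝ :=
  ∑ x ∈ S, (g x * discLap g x + (ξf x - lam) * σf x * g x ^ 2)

/-- Extension by zero of a function on `S`. -/
noncomputable def zeroExt (S : Finset (V d)) (u : S → ℝ) (x : V d) : ℝ :=
  if h : x ∈ S then u ⟨x, h⟩ else 0

theorem zeroExt_coe (S : Finset (V d)) (u : S → ℝ) (x : S) : zeroExt S u x = u x := by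
  simp [zeroExt]

theorem zeroExt_of_notMem (S : Finset (V d)) (u : S → ℝ) {x : V d} (h : x ∉ S) :
    zeroExt S u x = 0 := by
  simp [zeroExt, h]

theorem zeroExt_restrict {S : Finset (V d)} {f : V d → ℝ} (hf : ∀ x ∉ S, f x = 0) :
    zeroExt S (fun x => f x) = f := by
  funext x
  by_cases h : x ∈ S
  · simp [zeroExt, h]
  · simp [zeroExt, h, hf x h]

/-- The symmetrised operator `σ^{-1/2} Δ σ^{-1/2} + ξ` on functions supported in `S`, where
`τ` stands for `σ^{-1/2}`. -/
noncomputable def symOp (τ ξf : V d → ℝ) (S : Finset (V d)) :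
    EuclideanSpace ℝ S →ₗ[ℝ] EuclideanSpace ℝ S where
  toFun u := WithLp.toLp 2 fun x : S =>
    τ x * discLap (fun w => τ w * zeroExt S u w) x + ξf x * u x
  map_add' u v := by
    ext x
    have h : (fun w => τ w * zeroExt S (u + v).ofLp w) =
        fun w => τ w * zeroExt S u w + τ w * zeroExt S v w := by
      funext w
      by_cases hw : w ∈ S <;> simp [zeroExt, hw, mul_add]
    simp only [h, discLap_add, PiLp.add_apply]
    ring
  map_smul' c u := by
    ext x
    have h : (fun w => τ w * zeroExt S (c • u).ofLp w) =
        fun w => c * (τ w * zeroExt S u w) := by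
      funext w
      by_cases hw : w ∈ S <;> simp [zeroExt, hw]
      ring
    simp only [h, discLap_const_mul, PiLp.smul_apply, smul_eq_mul, RingHom.id_apply]
    ring

open scoped InnerProductSpace in
theorem inner_symOp (τ ξf : V d → ℝ) (S : Finset (V d)) (u v : EuclideanSpace ℝ S) :
    ⟪symOp τ ξf S u, v⟫_ℝ =
      ∑ x ∈ S, (τ x * zeroExt S v x) * discLap (fun w => τ w * zeroExt S u w) x +
      ∑ x ∈ S, ξf x * zeroExt S u x * zeroExt S v x := by
  rw [← Finset.sum_add_distrib, ← Finset.sum_coe_sort, PiLp.inner_apply]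
  refine Finset.sum_congr rfl fun x _ => ?_
  simp only [zeroExt_coe, symOp, LinearMap.coe_mk, AddHom.coe_mk, RCLike.inner_apply, conj_trivial]
  ring

theorem symOp_isSymmetric (τ ξf : V d → ℝ) (S : Finset (V d)) : (symOp τ ξf S).IsSymmetric := by
  intro u v
  rw [inner_symOp, real_inner_comm, inner_symOp,
    sum_mul_discLap_comm S (f := fun w => τ w * zeroExt S v.ofLp w)
      (fun x hx => by simp [zeroExt_of_notMem S _ hx])
      (fun x hx => by simp [zeroExt_of_notMem S _ hx])]
  congr 1
  exact Finset.sum_congr rfl fun _ _ => by ring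

theorem exists_isDirEV_forall_dirForm_nonpos {σf : V d → ℝ} (hσ : ∀ x, 0 < σf x) (ξf : V d → ℝ)
    {S : Finset (V d)} (hS : S.Nonempty) :
    ∃ lam, IsDirEV σf ξf S lam ∧
      ∀ g : V d → ℝ, (∀ x ∉ S, g x = 0) → dirForm σf ξf S lam g ≤ 0 := by
  have := hS.to_subtype
  have hq : ∀ x, 0 < √(σf x) := fun x => Real.sqrt_pos.mpr (hσ x)
  have hsq : ∀ x, √(σf x) * √(σf x) = σf x := fun x => Real.mul_self_sqrt (hσ x).le
  obtain ⟨lam, hev, hle⟩ := exists_hasEigenvalue_forall_inner_le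
    (symOp_isSymmetric (fun x => (√(σf x))⁻¹) ξf S)
  refine ⟨lam, ?_, fun g hg => ?_⟩
  · obtain ⟨u, hu⟩ := hev.exists_hasEigenvector
    refine ⟨fun x => √(σf x) * zeroExt S u x, fun h0 => hu.2 ?_, fun x hx => ?_, fun x hx => ?_⟩
    · ext x
      have := congrFun h0 x
      simpa [zeroExt_coe, (hq x).ne'] using this
    · simp [zeroExt_of_notMem S _ (by simpa using hx)]
    · have h := congrArg (fun v : EuclideanSpace ℝ S => v ⟨x, hx⟩) hu.apply_eq_smul
      simp only [symOp, LinearMap.coe_mk, AddHom.coe_mk, PiLp.smul_apply, smul_eq_mul] at h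
      have hf : (fun w => √(σf w) * zeroExt S u w / σf w) =
          fun w => (√(σf w))⁻¹ * zeroExt S u w := by
        funext w
        have := (hq w).ne'
        nth_rewrite 2 [← hsq w]
        field_simp
      have hz : zeroExt S u x = u ⟨x, hx⟩ := zeroExt_coe S u ⟨x, hx⟩
      rw [bamOp, hf, hz]
      have := (hq x).ne'
      calc _ = √(σf x) * ((√(σf x))⁻¹ * discLap (fun w => (√(σf w))⁻¹ * zeroExt S u w) x
            + ξf x * u ⟨x, hx⟩) := by field_simp
        _ = _ := by rw [h, ← hz]; ring
  · have h := hle (WithLp.toLp 2 fun x : S => √(σf x) * g x)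
    have hz : zeroExt S (fun x : S => √(σf x) * g x) = fun x => √(σf x) * g x :=
      zeroExt_restrict (f := fun x => √(σf x) * g x) fun x hx => by simp [hg x hx]
    rw [inner_symOp, EuclideanSpace.real_norm_sq_eq] at h
    simp only [hz] at h
    rw [Finset.sum_coe_sort S (fun x => (√(σf x) * g x) ^ 2), Finset.mul_sum,
      ← Finset.sum_add_distrib, ← sub_nonpos, ← Finset.sum_sub_distrib] at h
    refine le_of_eq_of_le (Finset.sum_congr rfl fun x _ => ?_) h
    have hc : ∀ w, (√(σf w))⁻¹ * (√(σf w) * g w) = g w := fun w =>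
      inv_mul_cancel_left₀ (hq w).ne' _
    simp only [hc]
    linear_combination (lam - ξf x) * g x ^ 2 * hsq x

theorem IsDirEV.le_of_dirForm_le {σf ξf σf' ξf' : V d → ℝ} (hσ : ∀ x, 0 < σf' x)
    {S : Finset (V d)} {lam lam' : ℝ}
    (hQ : ∀ g : V d → ℝ, (∀ x ∉ S, g x = 0) → dirForm σf ξf S lam g ≤ 0)
    (hcmp : ∀ x ∈ S, (ξf' x - lam) * σf' x ≤ (ξf x - lam) * σf x)
    (hev : IsDirEV σf' ξf' S lam') : lam' ≤ lam := by
  obtain ⟨f, hf0, hfS, hf⟩ := hev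
  set g : V d → ℝ := fun x => f x / σf' x with hg
  have hgf : ∀ x, f x = σf' x * g x := fun x => by
    have := (hσ x).ne'
    simp only [hg]
    field_simp
  have hgS : ∀ x ∉ S, g x = 0 := fun x hx => by simp [hg, hfS x (by simpa using hx)]
  have hle : ∑ x ∈ S, (lam' - lam) * (σf' x * g x ^ 2) ≤ 0 := by
    refine (Finset.sum_le_sum fun x hx => ?_).trans (hQ g hgS)
    have h1 : discLap g x + ξf' x * f x = lam' * f x := hf x (by simpa using hx)
    rw [hgf] at h1
    have h2 := mul_le_mul_of_nonneg_right (hcmp x hx) (sq_nonneg (g x))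
    linear_combination h2 - g x * h1
  rw [← Finset.mul_sum] at hle
  obtain ⟨x, hx⟩ := Function.ne_iff.mp hf0
  have hxS : x ∈ S := by
    by_contra h
    exact hx (hfS x (by simpa using h))
  have hgx : g x ≠ 0 := div_ne_zero hx (hσ x).ne'
  have hpos : 0 < ∑ x ∈ S, σf' x * g x ^ 2 :=
    Finset.sum_pos' (fun w _ => mul_nonneg (hσ w).le (sq_nonneg _))
      ⟨x, hxS, mul_pos (hσ x) (by positivity)⟩
  by_contra! h
  exact absurd hle (not_le.mpr (mul_pos (sub_pos.mpr h) hpos))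

theorem prinEV_le_prinEV {σf ξf σf' ξf' : V d → ℝ} (hσ : ∀ x, 0 < σf x) (hσ' : ∀ x, 0 < σf' x)
    {S : Finset (V d)} (hS : S.Nonempty)
    (hcmp : ∀ lam, (∀ g : V d → ℝ, (∀ x ∉ S, g x = 0) → dirForm σf ξf S lam g ≤ 0) →
      ∀ x ∈ S, (ξf' x - lam) * σf' x ≤ (ξf x - lam) * σf x) :
    prinEV σf' ξf' S ≤ prinEV σf ξf S := by
  obtain ⟨lam, hev, hQ⟩ := exists_isDirEV_forall_dirForm_nonpos hσ ξf hS
  obtain ⟨lam', hev', -⟩ := exists_isDirEV_forall_dirForm_nonpos hσ' ξf' hS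
  calc prinEV σf' ξf' S ≤ lam :=
        csSup_le ⟨lam', hev'⟩ fun _ h => h.le_of_dirForm_le hσ' hQ (hcmp lam hQ)
    _ ≤ prinEV σf ξf S :=
        le_csSup ⟨lam, fun _ h => h.le_of_dirForm_le hσ hQ fun _ _ => le_rfl⟩ hev

theorem le_of_dirForm_nonpos (hd : 1 ≤ d) {σf ξf : V d → ℝ} {S : Finset (V d)} {z : V d}
    (hz : z ∈ S) (hσ : 0 < σf z) {lam : ℝ}
    (hQ : ∀ g : V d → ℝ, (∀ x ∉ S, g x = 0) → dirForm σf ξf S lam g ≤ 0) :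
    ξf z - (σf z)⁻¹ ≤ lam := by
  have h := hQ (fun w => if w = z then 1 else 0) fun x hx => if_neg (ne_of_mem_of_not_mem hz hx).symm
  rw [dirForm, Finset.sum_eq_single_of_mem z hz fun x _ hx => by simp [hx], discLap_single hd] at h
  simp only [if_true] at h
  have h' : ξf z - lam ≤ (σf z)⁻¹ := by
    rw [← one_div, le_div_iff₀ hσ]
    linarith
  linarith

theorem finite_lball (z : V d) (r : ℝ) : (lball z r).Finite := by
  refine (Set.finite_Icc (fun i => z i - ⌈r⌉) (fun i => z i + ⌈r⌉)).subset fun x hx => ?_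
  have h : ∀ i, |x i - z i| ≤ ⌈r⌉ := fun i => by
    have h1 : |((x - z) i : ℝ)| ≤ l1 (x - z) :=
      Finset.single_le_sum (f := fun i => |((x - z) i : ℝ)|) (fun _ _ => abs_nonneg _)
        (Finset.mem_univ i)
    have h2 : |((x - z) i : ℝ)| ≤ ⌈r⌉ := (h1.trans hx).trans (Int.le_ceil r)
    exact_mod_cast h2
  refine ⟨fun i => ?_, fun i => ?_⟩ <;> have := abs_le.mp (h i) <;> dsimp only <;> omega

theorem mem_lball_self (z : V d) {r : ℝ} (hr : 0 ≤ r) : z ∈ lball z r := by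
  simpa [lball, l1] using hr

theorem hatXiAt_mono (z : V d) (a δσ : ℝ) {ξf ξf' : V d → ℝ} (h : ξf ≤ ξf') (x : V d) :
    hatXiAt z a δσ ξf x ≤ hatXiAt z a δσ ξf' x := by
  unfold hatXiAt
  split_ifs
  · exact max_le_max_right _ (h z)
  · exact min_le_min_right _ (h x)

end

/-- Lemma 4.8 (Monotonicity of the truncated principal eigenvalue): for `y ≠ z`,
`λ̂_r(z)` is non-decreasing in `ξ(y)` and non-increasing in `σ(y) ∈ [δ_σ, ∞)`. -/
theorem truncated_eigenvalue_monotonicity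
    (d : ℕ) (hd : 1 ≤ d) (δσ : ℝ) (hδσ : 0 < δσ) (a : ℝ) (z : V d)
    (σf ξf : V d → ℝ) (hσ : ∀ x, δσ ≤ σf x)
    (r : ℝ) (hr : 0 < r) (y : V d) (hy : y ≠ z) :
    (∀ s s' : ℝ, s ≤ s' →
      prinEV σf (hatXiAt z a δσ (Function.update ξf y s)) (lball z r) ≤
      prinEV σf (hatXiAt z a δσ (Function.update ξf y s')) (lball z r)) ∧
    (∀ s s' : ℝ, δσ ≤ s → s ≤ s' →
      prinEV (Function.update σf y s') (hatXiAt z a δσ ξf) (lball z r) ≤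
      prinEV (Function.update σf y s) (hatXiAt z a δσ ξf) (lball z r)) := by
  have hσ0 : ∀ x, 0 < σf x := fun x => hδσ.trans_le (hσ x)
  obtain ⟨S, hS⟩ := (finite_lball z r).exists_finset_coe
  have hzS : z ∈ S := by
    rw [← Finset.mem_coe, hS]
    exact mem_lball_self z hr.le
  rw [← hS]
  refine ⟨fun s s' hss => ?_, fun s s' hs hss => ?_⟩
  · refine prinEV_le_prinEV hσ0 hσ0 ⟨z, hzS⟩ fun lam _ x _ => ?_
    have := hatXiAt_mono z a δσ (Function.update_mono (f := ξf) (i := y) hss) x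
    exact mul_le_mul_of_nonneg_right (sub_le_sub_right this lam) (hσ0 x).le
  · have hpos : ∀ t, δσ ≤ t → ∀ x, 0 < Function.update σf y t x := fun t ht x => by
      by_cases hx : x = y
      · subst hx
        simpa using hδσ.trans_le ht
      · simpa [hx] using hσ0 x
    refine prinEV_le_prinEV (hpos s hs) (hpos s' (hs.trans hss)) ⟨z, hzS⟩ fun lam hQ x _ => ?_
    by_cases hx : x = y
    · subst hx
      have h1 := le_of_dirForm_nonpos hd hzS (hpos s hs z) hQ
      rw [Function.update_of_ne hy.symm] at h1
      have h2 : (σf z)⁻¹ ≤ δσ⁻¹ := inv_anti₀ hδσ (hσ z)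
      have h3 : a - 4 / δσ + δσ⁻¹ ≤ hatXiAt z a δσ ξf z := by simp [hatXiAt]
      have h4 : hatXiAt z a δσ ξf x ≤ a - 4 / δσ := by simp [hatXiAt, hy]
      simp only [Function.update_self]
      exact mul_le_mul_of_nonpos_left hss (by linarith)
    · simp [hx]

end BAM
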